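/- arXiv:1906.06259 — 2 statements merged into one kernel-verified Lean document; each statement's English description precedes it below -/
import Mathlib

section
/- Let I be a square-free monomial ideal of R = k[x_1,...,x_n] (k a field) with associated Stanley–Reisner simplicial complex Δ = Δ(I). Suppose reg(I) ≤ r and pd(I) ≤ n - r. If χ̃(Δ) ≠ 0, then pd(I) = n - r. -/
/-- The faces of cardinality `m` of a simplicial complex, given as a finite
family of finite subsets of `Fin n`. -/
def cfaces {n : ℕ} (Δ : Finset (Finset (Fin n))) (m : ℕ) : Finset (Finset (Fin n)) :=
  Δ.filter (fun F => F.card = m)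

/-- The coefficient of the face `G` in the simplicial boundary of the face `F`
(with respect to the linear order on the vertices `Fin n`). -/
noncomputable def bcoeff (K : Type*) [Field K] {n : ℕ} (F G : Finset (Fin n)) : K :=
  ∑ v ∈ F, if F.erase v = G then (-1 : K) ^ (F.filter (fun w => w < v)).card else 0

/-- The simplicial boundary map from chains spanned by faces of cardinality `m+1`
to chains spanned by faces of cardinality `m` (so the augmentation map
corresponds to `m = 0`). -/
noncomputable def boundaryMap (K : Type*) [Field K] {n : ℕ}
    (Δ : Finset (Finset (Fin n))) (m : ℕ) :
    ({F // F ∈ cfaces Δ (m + 1)} → K) →ₗ[K] ({G // G ∈ cfaces Δ m} → K) :=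
  LinearMap.pi fun G => ∑ F : {F // F ∈ cfaces Δ (m + 1)}, bcoeff K F.1 G.1 • LinearMap.proj F

/-- The dimension over `K` of the `i`-th reduced simplicial homology of the
simplicial complex `Δ` (using the augmented chain complex, so that
`i = -1` is allowed). -/
noncomputable def reducedHomologyRank (K : Type*) [Field K] {n : ℕ}
    (Δ : Finset (Finset (Fin n))) (i : ℤ) : ℕ :=
  if i = -1 then
    Module.finrank K (({F // F ∈ cfaces Δ 0} → K) ⧸ LinearMap.range (boundaryMap K Δ 0))
  else if 0 ≤ i then
    Module.finrank K
      (↥(LinearMap.ker (boundaryMap K Δ i.toNat)) ⧸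
        Submodule.comap (LinearMap.ker (boundaryMap K Δ i.toNat)).subtype
          (LinearMap.range (boundaryMap K Δ (i.toNat + 1))))
  else 0

/-- The graded Betti numbers `β_{i,j}` of the Stanley–Reisner ideal of the
simplicial complex `Δ` over the field `K`, defined via Hochster's formula:
`β_{i,j} = ∑_{|W| = j} dim_K H̃_{j-i-2}(Δ_W; K)`. -/
noncomputable def bettiNumber (K : Type*) [Field K] {n : ℕ}
    (Δ : Finset (Finset (Fin n))) (i j : ℕ) : ℕ :=
  ∑ W ∈ Finset.powersetCard j (Finset.univ : Finset (Fin n)),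
    reducedHomologyRank K (Δ.filter (fun F => F ⊆ W)) ((j : ℤ) - (i : ℤ) - 2)

/-- The Castelnuovo–Mumford regularity `reg(I) = max { j - i | β_{i,j}(I) ≠ 0 }`
of the Stanley–Reisner ideal of `Δ` over `K`. -/
noncomputable def regSR (K : Type*) [Field K] {n : ℕ} (Δ : Finset (Finset (Fin n))) : ℕ :=
  sSup {d : ℕ | ∃ i j : ℕ, bettiNumber K Δ i j ≠ 0 ∧ (j : ℤ) - (i : ℤ) = d}

/-- The projective dimension `pd(I) = max { i | β_{i,j}(I) ≠ 0 for some j }`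
of the Stanley–Reisner ideal of `Δ` over `K`. -/
noncomputable def pdSR (K : Type*) [Field K] {n : ℕ} (Δ : Finset (Finset (Fin n))) : ℕ :=
  sSup {i : ℕ | ∃ j : ℕ, bettiNumber K Δ i j ≠ 0}

/-- The reduced Euler characteristic `χ̃(Δ) = ∑_{F ∈ Δ} (-1)^{|F| - 1}`
of a simplicial complex `Δ` (the alternating sum of the `f`-vector). -/
def eulerCharSR {n : ℕ} (Δ : Finset (Finset (Fin n))) : ℤ :=
  ∑ F ∈ Δ, (-1 : ℤ) ^ (F.card + 1)

/-- Two consecutive boundary coefficients compose to zero. -/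
theorem sum_bcoeff_mul_bcoeff (K : Type*) [Field K] {n : ℕ} {Γ : Finset (Finset (Fin n))}
    (F H : Finset (Fin n)) (hΓ : ∀ v ∈ F, F.erase v ∈ Γ) :
    ∑ G ∈ Γ, bcoeff K F G * bcoeff K G H = 0 := by
  have step : ∑ G ∈ Γ, bcoeff K F G * bcoeff K G H =
      ∑ v ∈ F, (-1 : K) ^ (F.filter (fun w => w < v)).card * bcoeff K (F.erase v) H := by
    simp_rw [bcoeff.eq_1 K F, Finset.sum_mul]
    rw [Finset.sum_comm]
    refine Finset.sum_congr rfl fun v hv => ?_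
    simp [ite_mul, hΓ v hv]
  rw [step]
  simp_rw [bcoeff, Finset.mul_sum]
  rw [Finset.sum_sigma']
  have sign : ∀ a b : Fin n, a ∈ F → b ∈ F → a < b →
      (-1 : K) ^ (F.filter (fun w => w < a)).card *
          (-1 : K) ^ ((F.erase a).filter (fun w => w < b)).card +
        (-1 : K) ^ (F.filter (fun w => w < b)).card *
          (-1 : K) ^ ((F.erase b).filter (fun w => w < a)).card = 0 := by
    intro a b ha hb hab
    have h1 : (F.erase b).filter (fun w => w < a) = F.filter (fun w => w < a) := by
      ext x
      simp only [Finset.mem_filter, Finset.mem_erase]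
      grind
    have h2 : ((F.erase a).filter (fun w => w < b)).card + 1 =
        (F.filter (fun w => w < b)).card := by
      rw [Finset.filter_erase]
      exact Finset.card_erase_add_one (by simp [ha, hab])
    rw [h1, ← h2, pow_succ]
    ring
  refine Finset.sum_involution (fun p _ => ⟨p.2, p.1⟩) ?_ ?_ ?_ ?_
  · rintro ⟨a, b⟩ hp
    simp only [Finset.mem_sigma, Finset.mem_erase] at hp
    obtain ⟨ha, hba, hb⟩ := hp
    simp only [Finset.erase_right_comm (a := b) (b := a)]
    split_ifs
    · rcases lt_or_gt_of_ne hba with h | h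
      · rw [add_comm]
        exact sign b a hb ha h
      · exact sign a b ha hb h
    · simp
  · rintro ⟨a, b⟩ hp _ heq
    simp only [Finset.mem_sigma, Finset.mem_erase] at hp
    simp only [Sigma.mk.injEq] at heq
    exact hp.2.1 heq.1
  · rintro ⟨a, b⟩ hp
    simp only [Finset.mem_sigma, Finset.mem_erase] at hp ⊢
    exact ⟨hp.2.2, hp.2.1.symm, hp.1⟩
  · rintro ⟨a, b⟩ _
    rfl

theorem range_boundaryMap_succ_le_ker (K : Type*) [Field K] {n : ℕ}
    {Δ : Finset (Finset (Fin n))} (hΔ : ∀ F ∈ Δ, ∀ v ∈ F, F.erase v ∈ Δ) (m : ℕ) :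
    LinearMap.range (boundaryMap K Δ (m + 1)) ≤ LinearMap.ker (boundaryMap K Δ m) := by
  rintro _ ⟨x, rfl⟩
  rw [LinearMap.mem_ker]
  ext H
  simp only [boundaryMap, LinearMap.pi_apply, LinearMap.sum_apply, LinearMap.smul_apply,
    LinearMap.proj_apply, smul_eq_mul, Pi.zero_apply, Finset.mul_sum]
  rw [Finset.sum_comm]
  refine Finset.sum_eq_zero fun F _ => ?_
  have hF := F.2
  simp only [cfaces, Finset.mem_filter] at hF
  have key := sum_bcoeff_mul_bcoeff K (Γ := cfaces Δ (m + 1)) F.1 H.1 fun v hv => by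
    simp only [cfaces, Finset.mem_filter]
    exact ⟨hΔ _ hF.1 v hv, by rw [Finset.card_erase_of_mem hv, hF.2]; rfl⟩
  rw [← Finset.sum_coe_sort] at key
  calc ∑ G : {G // G ∈ cfaces Δ (m + 1)}, bcoeff K G.1 H.1 * (bcoeff K F.1 G.1 * x F)
      = (∑ G : {G // G ∈ cfaces Δ (m + 1)}, bcoeff K F.1 G.1 * bcoeff K G.1 H.1) * x F := by
        rw [Finset.sum_mul]
        exact Finset.sum_congr rfl fun G _ => by ring
    _ = 0 := by rw [key, zero_mul]

theorem eulerCharSR_eq_sum_card_cfaces {n : ℕ} (Δ : Finset (Finset (Fin n))) :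
    eulerCharSR Δ = ∑ m ∈ Finset.range (n + 1), (-1 : ℤ) ^ (m + 1) * (cfaces Δ m).card := by
  rw [eulerCharSR, ← Finset.sum_fiberwise_of_maps_to (g := Finset.card)
    (t := Finset.range (n + 1))]
  · refine Finset.sum_congr rfl fun m _ => ?_
    rw [Finset.sum_congr rfl (g := fun _ => (-1 : ℤ) ^ (m + 1)), Finset.sum_const, cfaces,
      nsmul_eq_mul, mul_comm]
    intro F hF
    rw [(Finset.mem_filter.1 hF).2]
  · intro F _
    simpa [Nat.lt_succ_iff] using Finset.card_le_univ F

/-- An acyclic augmented chain complex has vanishing reduced Euler characteristic. -/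
theorem eulerCharSR_eq_zero_of_exact (K : Type*) [Field K] {n : ℕ}
    {Δ : Finset (Finset (Fin n))}
    (h0 : LinearMap.range (boundaryMap K Δ 0) = ⊤)
    (hex : ∀ m, LinearMap.range (boundaryMap K Δ (m + 1)) = LinearMap.ker (boundaryMap K Δ m)) :
    eulerCharSR Δ = 0 := by
  have hf0 : (cfaces Δ 0).card = Module.finrank K (LinearMap.range (boundaryMap K Δ 0)) := by
    rw [h0, finrank_top]
    simp
  have hf : ∀ m, (cfaces Δ (m + 1)).card =
      Module.finrank K (LinearMap.range (boundaryMap K Δ m)) +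
        Module.finrank K (LinearMap.range (boundaryMap K Δ (m + 1))) := by
    intro m
    rw [hex, LinearMap.finrank_range_add_finrank_ker]
    simp
  have partialSum : ∀ M, ∑ m ∈ Finset.range (M + 1), (-1 : ℤ) ^ (m + 1) * (cfaces Δ m).card =
      (-1) ^ (M + 1) * Module.finrank K (LinearMap.range (boundaryMap K Δ M)) := by
    intro M
    induction M with
    | zero => simp [hf0]
    | succ M ih =>
      rw [Finset.sum_range_succ, ih, hf]
      push_cast
      ring
  have htop : (cfaces Δ (n + 1)).card = 0 := by
    rw [Finset.card_eq_zero]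
    refine Finset.filter_eq_empty_iff.2 fun F _ hF => ?_
    have := Finset.card_le_univ F
    simp at this
    omega
  have hn := hf n
  rw [htop] at hn
  rw [eulerCharSR_eq_sum_card_cfaces, partialSum,
    show Module.finrank K (LinearMap.range (boundaryMap K Δ n)) = 0 by omega]
  simp

theorem range_boundaryMap_zero_of_reducedHomologyRank_eq_zero (K : Type*) [Field K] {n : ℕ}
    {Δ : Finset (Finset (Fin n))} (h : reducedHomologyRank K Δ (-1) = 0) :
    LinearMap.range (boundaryMap K Δ 0) = ⊤ := by
  rw [reducedHomologyRank, if_pos rfl, Module.finrank_zero_iff,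
    Submodule.Quotient.subsingleton_iff] at h
  exact h

theorem ker_le_range_of_reducedHomologyRank_eq_zero (K : Type*) [Field K] {n : ℕ}
    {Δ : Finset (Finset (Fin n))} {m : ℕ} (h : reducedHomologyRank K Δ m = 0) :
    LinearMap.ker (boundaryMap K Δ m) ≤ LinearMap.range (boundaryMap K Δ (m + 1)) := by
  rw [reducedHomologyRank, if_neg (by omega), if_pos (by omega), Module.finrank_zero_iff,
    Submodule.Quotient.subsingleton_iff, Submodule.comap_subtype_eq_top] at h
  exact h

/-- A nonzero reduced Euler characteristic forces nonzero reduced homology in some degree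
`-1 ≤ i ≤ n - 2`, written here as `n - a - 2` with `a ≤ n`. -/
theorem exists_reducedHomologyRank_ne_zero (K : Type*) [Field K] {n : ℕ} (hn : n ≠ 0)
    {Δ : Finset (Finset (Fin n))} (hΔ : ∀ F ∈ Δ, ∀ G ⊆ F, G ∈ Δ) (hχ : eulerCharSR Δ ≠ 0) :
    ∃ a : ℕ, reducedHomologyRank K Δ ((n : ℤ) - a - 2) ≠ 0 := by
  by_contra! hall
  have huniv : Finset.univ ∉ Δ := by
    intro hu
    have hΔu : Δ = Finset.univ.powerset := by
      ext F
      simpa using hΔ _ hu F (Finset.subset_univ F)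
    refine hχ ?_
    have : Nonempty (Fin n) := ⟨⟨0, Nat.pos_of_ne_zero hn⟩⟩
    simp_rw [eulerCharSR, pow_succ, ← Finset.sum_mul]
    rw [hΔu, Finset.sum_powerset_neg_one_pow_card_of_nonempty Finset.univ_nonempty, zero_mul]
  refine hχ (eulerCharSR_eq_zero_of_exact K ?_ fun m => le_antisymm ?_ ?_)
  · refine range_boundaryMap_zero_of_reducedHomologyRank_eq_zero K ?_
    convert hall (n - 1) using 2
    omega
  · exact range_boundaryMap_succ_le_ker K (fun F hF v _ => hΔ F hF _ (F.erase_subset v)) m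
  · rcases le_or_gt (m + 2) n with hm | hm
    · refine ker_le_range_of_reducedHomologyRank_eq_zero K ?_
      convert hall (n - (m + 2)) using 2
      omega
    · have hempty : IsEmpty {F // F ∈ cfaces Δ (m + 1)} := by
        refine ⟨fun ⟨F, hF⟩ => ?_⟩
        rw [cfaces, Finset.mem_filter] at hF
        have hle : F.card ≤ n := by simpa using Finset.card_le_univ F
        have hFu : F = Finset.univ := by
          rw [← Finset.card_eq_iff_eq_univ, Fintype.card_fin]
          omega
        exact huniv (hFu ▸ hF.1)
      intro x _
      rw [Subsingleton.elim x 0]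
      exact zero_mem _

theorem le_and_le_of_bettiNumber_ne_zero (K : Type*) [Field K] {n : ℕ}
    {Δ : Finset (Finset (Fin n))} {i j : ℕ} (h : bettiNumber K Δ i j ≠ 0) : i ≤ j ∧ j ≤ n := by
  obtain ⟨W, hW, hne⟩ := Finset.exists_ne_zero_of_sum_ne_zero h
  refine ⟨?_, ?_⟩
  · by_contra hlt
    exact hne (by rw [reducedHomologyRank, if_neg (by omega), if_neg (by omega)])
  · rw [← (Finset.mem_powersetCard.1 hW).2]
    simpa using Finset.card_le_univ W

theorem le_pdSR (K : Type*) [Field K] {n : ℕ} {Δ : Finset (Finset (Fin n))} {i j : ℕ}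
    (h : bettiNumber K Δ i j ≠ 0) : i ≤ pdSR K Δ := by
  refine le_csSup ⟨n, ?_⟩ ⟨j, h⟩
  rintro a ⟨b, hb⟩
  have := le_and_le_of_bettiNumber_ne_zero K hb
  omega

theorem le_add_regSR (K : Type*) [Field K] {n : ℕ} {Δ : Finset (Finset (Fin n))} {i j : ℕ}
    (h : bettiNumber K Δ i j ≠ 0) : j ≤ i + regSR K Δ := by
  have hij := le_and_le_of_bettiNumber_ne_zero K h
  have : j - i ≤ regSR K Δ := by
    refine le_csSup ⟨n, ?_⟩ ⟨i, j, h, by omega⟩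
    rintro d ⟨a, b, hb, hd⟩
    have := le_and_le_of_bettiNumber_ne_zero K hb
    omega
  omega

theorem bettiNumber_top (K : Type*) [Field K] {n : ℕ} (Δ : Finset (Finset (Fin n))) (i : ℕ) :
    bettiNumber K Δ i n = reducedHomologyRank K Δ ((n : ℤ) - i - 2) := by
  have h : Finset.powersetCard n (Finset.univ : Finset (Fin n)) = {Finset.univ} := by
    simpa using Finset.powersetCard_self (Finset.univ : Finset (Fin n))
  rw [bettiNumber, h, Finset.sum_singleton, Finset.filter_true_of_mem fun F _ => F.subset_univ]

/-- **Theorem (projective-dimension analogue, part (ii)).**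
Let `I` be a square-free monomial ideal of `R = K[x_1, …, x_n]` with associated
Stanley–Reisner simplicial complex `Δ = Δ(I)`.  Suppose `reg(I) ≤ r` and
`pd(I) ≤ n - r`.  If `χ̃(Δ) ≠ 0`, then `pd(I) = n - r`. -/
theorem projective_dimension_of_squarefree_monomial_ideal_nonzero_euler
    (K : Type*) [Field K] (n r : ℕ)
    (I : Ideal (MvPolynomial (Fin n) K))
    (hsq : ∃ S : Set (Finset (Fin n)),
      I = Ideal.span ((fun F : Finset (Fin n) => ∏ v ∈ F, MvPolynomial.X v) '' S))
    (Δ : Finset (Finset (Fin n)))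
    (hΔ : ∀ F : Finset (Fin n),
      F ∈ Δ ↔ (∏ v ∈ F, MvPolynomial.X v : MvPolynomial (Fin n) K) ∉ I)
    (hreg : regSR K Δ ≤ r)
    (hpd : (pdSR K Δ : ℤ) ≤ (n : ℤ) - (r : ℤ))
    (hχ : eulerCharSR Δ ≠ 0) :
    (pdSR K Δ : ℤ) = (n : ℤ) - (r : ℤ) := by
  rcases eq_or_ne n 0 with hn | hn
  · omega
  have hdown : ∀ F ∈ Δ, ∀ G ⊆ F, G ∈ Δ := by
    intro F hF G hGF
    rw [hΔ] at hF ⊢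
    exact fun hG => hF (I.mem_of_dvd (Finset.prod_dvd_prod_of_subset _ _ _ hGF) hG)
  obtain ⟨a, ha⟩ := exists_reducedHomologyRank_ne_zero K hn hdown hχ
  rw [← bettiNumber_top] at ha
  have hpd' := le_pdSR K ha
  have hreg' := le_add_regSR K ha
  omega
end

section
/- Let t ≥ 1 and let B_t be the ladder graph with t squares: vertices a_1, ..., a_{t+1} and b_1, ..., b_{t+1}, with edges a_i a_{i+1} and b_i b_{i+1} for 1 ≤ i ≤ t, and rungs a_i b_i for 1 ≤ i ≤ t+1. Then the edge ideal I(B_t) satisfies reg(I(B_t)) ≤ (t+4)/2 if t is even and reg(I(B_t)) ≤ (t+3)/2 if t is odd. -/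
/-- The circulant graph `C_n(S)`: the graph on the vertex set `ZMod n`
(identified with `{x_1, …, x_n}`) in which `x` and `y` are adjacent if and only
if they differ by `±s (mod n)` for some `s ∈ S`. -/
def circulant (n : ℕ) (S : Set ℕ) : SimpleGraph (ZMod n) :=
  SimpleGraph.fromRel (fun x y => ∃ s ∈ S, y - x = (s : ZMod n))

/-- A graph is chordal if it has no induced cycle of length `m ≥ 4`.  Here an
induced `m`-cycle is an injection of the cycle `C_m = C_m(1)` whose image
induces exactly the cycle's adjacency. -/
def IsChordal {V : Type*} (G : SimpleGraph V) : Prop :=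
  ∀ m : ℕ, 4 ≤ m → ¬ ∃ f : ZMod m → V, Function.Injective f ∧
    ∀ a b : ZMod m, G.Adj (f a) (f b) ↔ (circulant m {1}).Adj a b

/-- A graph is claw-free if it has no induced subgraph isomorphic to the claw
`K_{1,3}`, i.e. there is no vertex adjacent to three pairwise non-adjacent
vertices. -/
def ClawFree {V : Type*} (G : SimpleGraph V) : Prop :=
  ¬ ∃ c x y z : V, x ≠ y ∧ x ≠ z ∧ y ≠ z ∧
    G.Adj c x ∧ G.Adj c y ∧ G.Adj c z ∧ ¬ G.Adj x y ∧ ¬ G.Adj x z ∧ ¬ G.Adj y z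

open Classical in
/-- The independence complex `Ind(G)` of a finite simple graph `G`, recorded
as a simplicial complex on `Fin (card V)` via a fixed identification of the
vertices with `Fin (card V)`.  It is the Stanley–Reisner complex of the edge
ideal `I(G)`. -/
noncomputable def indComplex {V : Type*} [Fintype V] (G : SimpleGraph V) :
    Finset (Finset (Fin (Fintype.card V))) :=
  Finset.univ.filter (fun F : Finset (Fin (Fintype.card V)) =>
    ∀ u ∈ F, ∀ v ∈ F,
      ¬ G.Adj ((Fintype.equivFin V).symm u) ((Fintype.equivFin V).symm v))

/-- The Castelnuovo–Mumford regularity `reg(I(G))` of the edge ideal of the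
finite simple graph `G` over the field `K`, computed (via Hochster's formula)
from the independence complex of `G`. -/
noncomputable def regEdgeIdeal (K : Type*) [Field K] {V : Type*} [Fintype V]
    (G : SimpleGraph V) : ℕ :=
  regSR K (indComplex G)

/-- The projective dimension `pd(I(G))` of the edge ideal of the finite simple
graph `G` over the field `K`, computed (via Hochster's formula) from the
independence complex of `G`. -/
noncomputable def pdEdgeIdeal (K : Type*) [Field K] {V : Type*} [Fintype V]
    (G : SimpleGraph V) : ℕ :=
  pdSR K (indComplex G)

/-- The graph `A_t`: a ladder with `t` squares together with a pendant edge
extending each of the two horizontal paths at one end.  The vertices are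
`a_0, …, a_{t+1}` (the row `(true, i) = a_i`) and `b_0, …, b_{t+1}` (the row
`(false, i) = b_i`), with edges `a_i a_{i+1}` and `b_i b_{i+1}` for
`0 ≤ i ≤ t`, and rungs `a_i b_i` for `1 ≤ i ≤ t+1`. -/
def graphA (t : ℕ) : SimpleGraph (Bool × Fin (t + 2)) :=
  SimpleGraph.fromRel (fun x y =>
    (x.1 = y.1 ∧ (y.2 : ℕ) = (x.2 : ℕ) + 1) ∨
    (x.2 = y.2 ∧ 1 ≤ (x.2 : ℕ) ∧ x.1 ≠ y.1))

/-- The ladder graph `B_t` with `t` squares: vertices `a_1, …, a_{t+1}` (the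
row `(true, i) = a_{i+1}`) and `b_1, …, b_{t+1}` (the row
`(false, i) = b_{i+1}`), with edges `a_i a_{i+1}` and `b_i b_{i+1}` for
`1 ≤ i ≤ t`, and rungs `a_i b_i` for `1 ≤ i ≤ t+1`. -/
def graphB (t : ℕ) : SimpleGraph (Bool × Fin (t + 1)) :=
  SimpleGraph.fromRel (fun x y =>
    (x.1 = y.1 ∧ (y.2 : ℕ) = (x.2 : ℕ) + 1) ∨
    (x.2 = y.2 ∧ x.1 ≠ y.1))

/-- The graph `D_t`: a ladder with `t` squares together with one pendant edge
extending the bottom path on the left and one pendant edge extending the top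
path on the right.  The vertices are `a_1, …, a_{t+2}` (the top row
`(true, i) = a_{i+1}`) and `b_0, …, b_{t+1}` (the bottom row
`(false, i) = b_i`), with edges `a_i a_{i+1}` for `1 ≤ i ≤ t+1`, edges
`b_i b_{i+1}` for `0 ≤ i ≤ t`, and rungs `a_i b_i` for `1 ≤ i ≤ t+1`. -/
def graphD (t : ℕ) : SimpleGraph (Bool × Fin (t + 2)) :=
  SimpleGraph.fromRel (fun x y =>
    (y.2 : ℕ) = (x.2 : ℕ) + 1 ∧ (x.1 = y.1 ∨ (x.1 = true ∧ y.1 = false)))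

/-- The sign `(-1) ^ #{w ∈ F | w < v}` with which the vertex `v` enters the face `F`. -/
def vertexSign (K : Type*) [Field K] {n : ℕ} (v : Fin n) (F : Finset (Fin n)) : K :=
  (-1) ^ (F.filter (fun w => w < v)).card

section Chains

variable {K : Type*} [Field K] {n : ℕ}

lemma vertexSign_mul_self (v : Fin n) (F : Finset (Fin n)) :
    vertexSign K v F * vertexSign K v F = 1 := by
  rw [vertexSign, ← mul_pow]; simp

lemma vertexSign_insert {v x : Fin n} {F : Finset (Fin n)} (h : x ∉ F) :
    vertexSign K v (insert x F) = (if x < v then -1 else 1) * vertexSign K v F := by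
  unfold vertexSign
  rw [Finset.filter_insert]
  split_ifs with hx
  · rw [Finset.card_insert_of_notMem (by simp [h]), pow_succ]; ring
  · simp

lemma vertexSign_erase_self (v : Fin n) (F : Finset (Fin n)) :
    vertexSign K v (F.erase v) = vertexSign K v F := by
  by_cases h : v ∈ F
  · conv_rhs => rw [← Finset.insert_erase h, vertexSign_insert (Finset.notMem_erase v F)]
    simp
  · rw [Finset.erase_eq_of_notMem h]

/-- Contraction of a chain by the vertex `v`. -/
def contractVertex (K : Type*) [Field K] {n : ℕ} (v : Fin n) :
    Module.End K (Finset (Fin n) → K) where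
  toFun c G := if v ∈ G then 0 else vertexSign K v G * c (insert v G)
  map_add' c d := by ext G; simp only [Pi.add_apply]; split_ifs <;> ring
  map_smul' a c := by
    ext G; simp only [Pi.smul_apply, smul_eq_mul, RingHom.id_apply]; split_ifs <;> ring

/-- The cone over a chain with apex `v`. -/
def coneVertex (K : Type*) [Field K] {n : ℕ} (v : Fin n) :
    Module.End K (Finset (Fin n) → K) where
  toFun c G := if v ∈ G then vertexSign K v G * c (G.erase v) else 0
  map_add' c d := by ext G; simp only [Pi.add_apply]; split_ifs <;> ring
  map_smul' a c := by
    ext G; simp only [Pi.smul_apply, smul_eq_mul, RingHom.id_apply]; split_ifs <;> ring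

lemma contractVertex_apply (v : Fin n) (c : Finset (Fin n) → K) (G : Finset (Fin n)) :
    contractVertex K v c G = if v ∈ G then 0 else vertexSign K v G * c (insert v G) := rfl

lemma coneVertex_apply (v : Fin n) (c : Finset (Fin n) → K) (G : Finset (Fin n)) :
    coneVertex K v c G = if v ∈ G then vertexSign K v G * c (G.erase v) else 0 := rfl

lemma contractVertex_mul_self (v : Fin n) : contractVertex K v * contractVertex K v = 0 := by
  refine LinearMap.ext fun c => funext fun G => ?_
  simp [Module.End.mul_apply, contractVertex_apply]

lemma contractVertex_anticomm (v w : Fin n) :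
    contractVertex K v * contractVertex K w + contractVertex K w * contractVertex K v = 0 := by
  rcases eq_or_ne v w with rfl | hvw
  · simp [contractVertex_mul_self]
  refine LinearMap.ext fun c => funext fun G => ?_
  simp only [LinearMap.add_apply, Module.End.mul_apply, contractVertex_apply, Pi.add_apply,
    Finset.mem_insert, hvw, hvw.symm, false_or, LinearMap.zero_apply, Pi.zero_apply]
  by_cases hv : v ∈ G
  · simp [hv]
  by_cases hw : w ∈ G
  · simp [hw]
  simp only [hv, hw, if_false, vertexSign_insert hv, vertexSign_insert hw,
    Finset.insert_comm v w G]
  rcases lt_or_gt_of_ne hvw with h | h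
  · simp only [h, h.not_gt, if_true, if_false]; ring
  · simp only [h, h.not_gt, if_true, if_false]; ring

lemma contractVertex_coneVertex_self (v : Fin n) :
    contractVertex K v * coneVertex K v + coneVertex K v * contractVertex K v = 1 := by
  refine LinearMap.ext fun c => funext fun G => ?_
  simp only [LinearMap.add_apply, Module.End.mul_apply, contractVertex_apply, coneVertex_apply,
    Pi.add_apply, Finset.mem_insert, true_or, if_true, Module.End.one_apply]
  by_cases hv : v ∈ G
  · simp only [hv, if_true, Finset.notMem_erase, if_false, vertexSign_erase_self,
      Finset.insert_erase hv, ← mul_assoc, vertexSign_mul_self]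
    ring
  · simp only [hv, if_false, vertexSign_insert hv, lt_irrefl, one_mul, Finset.erase_insert hv,
      ← mul_assoc, vertexSign_mul_self, add_zero]

lemma contractVertex_coneVertex_of_ne {v w : Fin n} (hvw : v ≠ w) :
    contractVertex K v * coneVertex K w + coneVertex K w * contractVertex K v = 0 := by
  refine LinearMap.ext fun c => funext fun G => ?_
  simp only [LinearMap.add_apply, Module.End.mul_apply, contractVertex_apply, coneVertex_apply,
    Pi.add_apply, Finset.mem_insert, hvw.symm, false_or, LinearMap.zero_apply, Pi.zero_apply,
    Finset.mem_erase, ne_eq, hvw, not_false_eq_true, true_and]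
  by_cases hv : v ∈ G
  · simp [hv]
  by_cases hw : w ∈ G
  · have h1 : vertexSign K v G = (if w < v then -1 else 1) * vertexSign K v (G.erase w) := by
      conv_lhs => rw [← Finset.insert_erase hw, vertexSign_insert (Finset.notMem_erase w G)]
    simp only [hv, hw, if_true, if_false, vertexSign_insert hv, h1,
      Finset.erase_insert_of_ne hvw]
    rcases lt_or_gt_of_ne hvw with h | h
    · simp only [h, h.not_gt, if_true, if_false]; ring
    · simp only [h, h.not_gt, if_true, if_false]; ring
  · simp [hw]

/-- The simplicial boundary on all chains of the full simplex. -/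
def fullBoundary (K : Type*) [Field K] (n : ℕ) : Module.End K (Finset (Fin n) → K) :=
  ∑ v, contractVertex K v

lemma fullBoundary_apply (c : Finset (Fin n) → K) (G : Finset (Fin n)) :
    fullBoundary K n c G = ∑ v, contractVertex K v c G := by
  simp [fullBoundary, LinearMap.sum_apply, Finset.sum_apply]

lemma fullBoundary_mul_self : fullBoundary K n * fullBoundary K n = 0 := by
  rw [fullBoundary, Finset.sum_mul_sum, ← Finset.sum_product']
  refine Finset.sum_involution (fun p _ => (p.2, p.1)) ?_ ?_ ?_ ?_
  · intro p _; exact contractVertex_anticomm _ _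
  · rintro ⟨v, w⟩ _ h heq
    simp only [Prod.mk.injEq] at heq
    obtain ⟨rfl, -⟩ := heq
    exact h (contractVertex_mul_self _)
  · simp
  · simp

lemma fullBoundary_contractVertex (v : Fin n) :
    fullBoundary K n * contractVertex K v + contractVertex K v * fullBoundary K n = 0 := by
  rw [fullBoundary, Finset.sum_mul, Finset.mul_sum, ← Finset.sum_add_distrib]
  exact Finset.sum_eq_zero fun w _ => contractVertex_anticomm _ _

lemma fullBoundary_coneVertex (v : Fin n) :
    fullBoundary K n * coneVertex K v + coneVertex K v * fullBoundary K n = 1 := by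
  rw [fullBoundary, Finset.sum_mul, Finset.mul_sum, ← Finset.sum_add_distrib,
    Finset.sum_eq_single v _ (by simp), contractVertex_coneVertex_self]
  intro w _ h
  exact contractVertex_coneVertex_of_ne h

lemma fullBoundary_apply_eq_sum_bcoeff (c : Finset (Fin n) → K) (G : Finset (Fin n)) :
    fullBoundary K n c G = ∑ F, bcoeff K F G * c F := by
  have h : ∀ F, bcoeff K F G * c F =
      ∑ v, if v ∈ F ∧ F.erase v = G then vertexSign K v F * c F else 0 := by
    intro F
    simp only [bcoeff, ite_and, Finset.sum_ite_mem, Finset.univ_inter, Finset.sum_mul, ite_mul,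
      zero_mul, vertexSign]
  rw [fullBoundary_apply]
  simp_rw [h]
  rw [Finset.sum_comm]
  refine Finset.sum_congr rfl fun v _ => ?_
  rw [contractVertex_apply]
  split_ifs with hv
  · refine (Finset.sum_eq_zero fun F _ => if_neg ?_).symm
    rintro ⟨-, rfl⟩
    simp at hv
  · rw [Finset.sum_eq_single (insert v G)]
    · simp [hv, vertexSign_insert hv]
    · rintro F - hF
      refine if_neg ?_
      rintro ⟨hvF, rfl⟩
      exact hF (Finset.insert_erase hvF).symm
    · simp

/-- The chain `c` is supported on the faces of `Δ` of cardinality `m`. -/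
def IsChainOf (Δ : Finset (Finset (Fin n))) (m : ℕ) (c : Finset (Fin n) → K) : Prop :=
  ∀ F, c F ≠ 0 → F ∈ Δ ∧ F.card = m

/-- Every cycle supported on the faces of cardinality `m` of `Δ` is a boundary, i.e. the reduced
homology of `Δ` vanishes in dimension `m - 1`. -/
def AcyclicAt (K : Type*) [Field K] {n : ℕ} (Δ : Finset (Finset (Fin n))) (m : ℕ) : Prop :=
  ∀ c : Finset (Fin n) → K, IsChainOf Δ m c → fullBoundary K n c = 0 →
    ∃ e, IsChainOf Δ (m + 1) e ∧ fullBoundary K n e = c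

lemma IsChainOf.add {Δ : Finset (Finset (Fin n))} {m : ℕ} {c d : Finset (Fin n) → K}
    (hc : IsChainOf Δ m c) (hd : IsChainOf Δ m d) : IsChainOf Δ m (c + d) := by
  intro F hF
  by_cases h : c F = 0
  · exact hd F fun h' => hF (by simp [h, h'])
  · exact hc F h

lemma IsChainOf.neg {Δ : Finset (Finset (Fin n))} {m : ℕ} {c : Finset (Fin n) → K}
    (hc : IsChainOf Δ m c) : IsChainOf Δ m (-c) :=
  fun F hF => hc F (by simpa using hF)

lemma IsChainOf.mono {Δ Γ : Finset (Finset (Fin n))} {m : ℕ} {c : Finset (Fin n) → K}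
    (hc : IsChainOf Δ m c) (h : Δ ⊆ Γ) : IsChainOf Γ m c :=
  fun F hF => ⟨h (hc F hF).1, (hc F hF).2⟩

lemma IsChainOf.coneVertex {Δ Γ : Finset (Finset (Fin n))} {m : ℕ} {c : Finset (Fin n) → K}
    (hc : IsChainOf Γ m c) {x : Fin n} (h : ∀ F ∈ Γ, insert x F ∈ Δ) :
    IsChainOf Δ (m + 1) (coneVertex K x c) := by
  intro F hF
  rw [coneVertex_apply] at hF
  split_ifs at hF with hx
  · obtain ⟨h1, h2⟩ := hc _ (right_ne_zero_of_mul hF)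
    refine ⟨by simpa [Finset.insert_erase hx] using h _ h1, ?_⟩
    rw [← h2, Finset.card_erase_add_one hx]
  · exact absurd rfl hF

lemma IsChainOf.fullBoundary_eq_zero {Δ : Finset (Finset (Fin n))} {c : Finset (Fin n) → K}
    (hc : IsChainOf Δ 0 c) : fullBoundary K n c = 0 := by
  ext G
  rw [fullBoundary_apply]
  refine Finset.sum_eq_zero fun v _ => ?_
  rw [contractVertex_apply]
  split_ifs
  · rfl
  · by_contra h
    have := (hc _ (right_ne_zero_of_mul h)).2
    simp at this

lemma IsChainOf.fullBoundary {Δ : Finset (Finset (Fin n))} {m : ℕ} {c : Finset (Fin n) → K}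
    (hc : IsChainOf Δ (m + 1) c) (hΔ : ∀ F ∈ Δ, ∀ G ⊆ F, G ∈ Δ) :
    IsChainOf Δ m (fullBoundary K n c) := by
  intro G hG
  rw [fullBoundary_apply] at hG
  obtain ⟨v, -, hv⟩ := Finset.exists_ne_zero_of_sum_ne_zero hG
  rw [contractVertex_apply] at hv
  split_ifs at hv with h
  · exact absurd rfl hv
  · obtain ⟨h1, h2⟩ := hc _ (right_ne_zero_of_mul hv)
    rw [Finset.card_insert_of_notMem h] at h2
    exact ⟨hΔ _ h1 _ (Finset.subset_insert _ _), by omega⟩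

lemma fullBoundary_coneVertex_apply (x : Fin n) (c : Finset (Fin n) → K) :
    fullBoundary K n (coneVertex K x c) = c - coneVertex K x (fullBoundary K n c) :=
  eq_sub_of_add_eq (LinearMap.congr_fun (fullBoundary_coneVertex x) c)

/-- A cone is acyclic. -/
lemma acyclicAt_of_insert_mem {Δ : Finset (Finset (Fin n))} {x : Fin n}
    (h : ∀ F ∈ Δ, insert x F ∈ Δ) (m : ℕ) : AcyclicAt K Δ m := by
  intro c hc h0
  exact ⟨_, hc.coneVertex h, by rw [fullBoundary_coneVertex_apply, h0]; simp⟩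

lemma acyclicAt_zero_of_singleton_mem {Δ : Finset (Finset (Fin n))} {x : Fin n}
    (h : {x} ∈ Δ) : AcyclicAt K Δ 0 := by
  intro c hc h0
  have hc' : IsChainOf {∅} 0 c := fun F hF => ⟨by simpa using (hc F hF).2, (hc F hF).2⟩
  exact ⟨_, hc'.coneVertex (x := x) (by simpa using h),
    by rw [fullBoundary_coneVertex_apply, h0]; simp⟩

/-- If the deletion `Γ` and the link `Λ` of a vertex `x` are acyclic in the appropriate degrees,
then so is the complex. -/
lemma acyclicAt_of_deletion_of_link {Δ Γ Λ : Finset (Finset (Fin n))} {x : Fin n} {m : ℕ}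
    (hΓ : ∀ F, F ∈ Γ ↔ F ∈ Δ ∧ x ∉ F) (hΛ : ∀ F, F ∈ Λ ↔ insert x F ∈ Δ ∧ x ∉ F)
    (hΔ : ∀ F ∈ Δ, ∀ G ⊆ F, G ∈ Δ)
    (h1 : AcyclicAt K Γ (m + 1)) (h2 : AcyclicAt K Λ m) : AcyclicAt K Δ (m + 1) := by
  intro c hc h0
  have hlink : IsChainOf Λ m (contractVertex K x c) := by
    intro F hF
    rw [contractVertex_apply] at hF
    split_ifs at hF with hx
    · exact absurd rfl hF
    · obtain ⟨h3, h4⟩ := hc _ (right_ne_zero_of_mul hF)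
      rw [Finset.card_insert_of_notMem hx] at h4
      exact ⟨(hΛ F).2 ⟨h3, hx⟩, by omega⟩
  have hcyc : fullBoundary K n (contractVertex K x c) = 0 := by
    have := LinearMap.congr_fun (fullBoundary_contractVertex (K := K) x) c
    simpa [Module.End.mul_apply, h0] using this
  obtain ⟨e, he, hec⟩ := h2 _ hlink hcyc
  have hΛΓ : Λ ⊆ Γ := fun F hF =>
    (hΓ F).2 ⟨hΔ _ ((hΛ F).1 hF).1 _ (Finset.subset_insert _ _), ((hΛ F).1 hF).2⟩
  have hcone : IsChainOf Δ (m + 2) (coneVertex K x e) :=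
    he.coneVertex fun F hF => ((hΛ F).1 hF).1
  have hrest : IsChainOf Γ (m + 1) (contractVertex K x (coneVertex K x c)) := by
    intro F hF
    rw [contractVertex_apply] at hF
    split_ifs at hF with hx
    · exact absurd rfl hF
    · rw [coneVertex_apply, if_pos (Finset.mem_insert_self _ _), Finset.erase_insert hx] at hF
      obtain ⟨h3, h4⟩ := hc _ (right_ne_zero_of_mul (right_ne_zero_of_mul hF))
      exact ⟨(hΓ F).2 ⟨h3, hx⟩, h4⟩
  have hsplit : c + fullBoundary K n (coneVertex K x e) =
      contractVertex K x (coneVertex K x c) + e := by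
    have := LinearMap.congr_fun (contractVertex_coneVertex_self (K := K) x) c
    simp only [LinearMap.add_apply, Module.End.mul_apply, Module.End.one_apply] at this
    rw [fullBoundary_coneVertex_apply, hec]
    nth_rewrite 1 [← this]
    abel
  obtain ⟨g, hg, hgc⟩ := h1 _ (hrest.add (he.mono hΛΓ)) (by
    rw [← hsplit, map_add, h0, zero_add]
    exact LinearMap.congr_fun fullBoundary_mul_self _)
  refine ⟨g + -coneVertex K x e,
    (hg.mono fun F hF => ((hΓ F).1 hF).1).add hcone.neg, ?_⟩
  rw [map_add, map_neg, hgc, ← hsplit]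
  abel

/-- Extension by zero of a chain on the faces of cardinality `m` of `Δ`. -/
def extendChain (Δ : Finset (Finset (Fin n))) (m : ℕ) (c : {F // F ∈ cfaces Δ m} → K) :
    Finset (Fin n) → K :=
  fun F => if h : F ∈ cfaces Δ m then c ⟨F, h⟩ else 0

lemma isChainOf_extendChain (Δ : Finset (Finset (Fin n))) (m : ℕ)
    (c : {F // F ∈ cfaces Δ m} → K) : IsChainOf Δ m (extendChain Δ m c) := by
  intro F hF
  unfold extendChain at hF
  split_ifs at hF with h
  · simpa [cfaces] using h
  · exact absurd rfl hF

lemma IsChainOf.extendChain_restrict {Δ : Finset (Finset (Fin n))} {m : ℕ}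
    {c : Finset (Fin n) → K} (hc : IsChainOf Δ m c) :
    extendChain Δ m (fun F => c F.1) = c := by
  ext F
  unfold extendChain
  split_ifs with h
  · rfl
  · by_contra h'
    exact h (by simpa [cfaces] using hc F (Ne.symm h'))

lemma boundaryMap_apply_eq_fullBoundary (Δ : Finset (Finset (Fin n))) (m : ℕ)
    (c : {F // F ∈ cfaces Δ (m + 1)} → K) (G : {G // G ∈ cfaces Δ m}) :
    boundaryMap K Δ m c G = fullBoundary K n (extendChain Δ (m + 1) c) G.1 := by
  rw [fullBoundary_apply_eq_sum_bcoeff]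
  simp only [boundaryMap, LinearMap.pi_apply, LinearMap.sum_apply, LinearMap.smul_apply,
    LinearMap.proj_apply, smul_eq_mul]
  rw [← Finset.sum_subset (Finset.subset_univ (cfaces Δ (m + 1))),
    ← Finset.sum_coe_sort (cfaces Δ (m + 1))]
  · exact Finset.sum_congr rfl fun F _ => by simp [extendChain]
  · intro F _ hF
    simp [extendChain, hF]

lemma AcyclicAt.exists_boundaryMap_eq {Δ : Finset (Finset (Fin n))} {m : ℕ}
    (h : AcyclicAt K Δ m) (c : {F // F ∈ cfaces Δ m} → K)
    (hc : fullBoundary K n (extendChain Δ m c) = 0) :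
    c ∈ LinearMap.range (boundaryMap K Δ m) := by
  obtain ⟨e, he, hec⟩ := h _ (isChainOf_extendChain Δ m c) hc
  refine ⟨fun F => e F.1, ?_⟩
  ext G
  rw [boundaryMap_apply_eq_fullBoundary, he.extendChain_restrict, hec]
  simp [extendChain]

lemma AcyclicAt.reducedHomologyRank_eq_zero {Δ : Finset (Finset (Fin n))}
    (hΔ : ∀ F ∈ Δ, ∀ G ⊆ F, G ∈ Δ) {m : ℕ} (h : AcyclicAt K Δ m) :
    reducedHomologyRank K Δ ((m : ℤ) - 1) = 0 := by
  rcases m with _ | m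
  · rw [reducedHomologyRank, if_pos (by simp)]
    have : LinearMap.range (boundaryMap K Δ 0) = ⊤ := by
      rw [eq_top_iff]
      exact fun c _ => h.exists_boundaryMap_eq c
        (isChainOf_extendChain Δ 0 c).fullBoundary_eq_zero
    have := Submodule.Quotient.subsingleton_iff.2 this
    exact Module.finrank_zero_of_subsingleton
  · have hm : ((m + 1 : ℕ) : ℤ) - 1 = m := by push_cast; ring
    rw [hm, reducedHomologyRank, if_neg (by omega), if_pos (by omega), Int.toNat_natCast]
    have : Submodule.comap (LinearMap.ker (boundaryMap K Δ m)).subtype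
        (LinearMap.range (boundaryMap K Δ (m + 1))) = ⊤ := by
      rw [eq_top_iff]
      rintro ⟨c, hc⟩ -
      refine h.exists_boundaryMap_eq c ?_
      ext G
      by_contra hG
      obtain ⟨h1, h2⟩ := (isChainOf_extendChain Δ (m + 1) c).fullBoundary hΔ G hG
      refine hG ?_
      rw [← boundaryMap_apply_eq_fullBoundary Δ m c ⟨G, by simp [cfaces, h1, h2]⟩,
        LinearMap.mem_ker.1 hc]
      rfl
    have := Submodule.Quotient.subsingleton_iff.2 this
    exact Module.finrank_zero_of_subsingleton

end Chains

section Induced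

variable (K : Type*) [Field K] {V : Type*} [Fintype V] [DecidableEq V] (G : SimpleGraph V)

/-- The independence complex of the subgraph of `G` induced on `S`, as a subcomplex of
`indComplex G`. -/
noncomputable def inducedIndComplex {V : Type*} [Fintype V] (G : SimpleGraph V) (S : Finset V) :
    Finset (Finset (Fin (Fintype.card V))) :=
  (indComplex G).filter (fun F => F ⊆ S.map (Fintype.equivFin V).toEmbedding)

variable {G}

lemma mem_inducedIndComplex {S : Finset V} {F : Finset (Fin (Fintype.card V))} :
    F ∈ inducedIndComplex G S ↔
      (∀ u ∈ F, ∀ v ∈ F,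
        ¬ G.Adj ((Fintype.equivFin V).symm u) ((Fintype.equivFin V).symm v)) ∧
      ∀ u ∈ F, (Fintype.equivFin V).symm u ∈ S := by
  simp only [inducedIndComplex, indComplex, Finset.mem_filter, Finset.mem_univ, true_and,
    Finset.subset_iff, Finset.mem_map_equiv]

lemma mem_inducedIndComplex_of_subset {S : Finset V} :
    ∀ F ∈ inducedIndComplex G S, ∀ F' ⊆ F, F' ∈ inducedIndComplex G S := by
  intro F hF F' h
  rw [mem_inducedIndComplex] at hF ⊢
  exact ⟨fun u hu v hv => hF.1 u (h hu) v (h hv), fun u hu => hF.2 u (h hu)⟩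

lemma insert_mem_inducedIndComplex {S : Finset V} {x : V} {F : Finset (Fin (Fintype.card V))} :
    insert (Fintype.equivFin V x) F ∈ inducedIndComplex G S ↔
      F ∈ inducedIndComplex G S ∧ x ∈ S ∧
        ∀ u ∈ F, ¬ G.Adj x ((Fintype.equivFin V).symm u) := by
  simp only [mem_inducedIndComplex, Finset.mem_insert, forall_eq_or_imp, Equiv.symm_apply_apply,
    SimpleGraph.irrefl, not_false_eq_true, true_and]
  constructor
  · rintro ⟨⟨h1, h2⟩, h3, h4⟩
    exact ⟨⟨fun u hu => (h2 u hu).2, h4⟩, h3, h1⟩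
  · rintro ⟨⟨h1, h2⟩, h3, h4⟩
    exact ⟨⟨h4, fun u hu => ⟨fun h => h4 u hu h.symm, h1 u hu⟩⟩, h3, h2⟩

lemma eq_empty_of_not_acyclicAt_zero {S : Finset V}
    (h : ¬ AcyclicAt K (inducedIndComplex G S) 0) : S = ∅ := by
  by_contra hS
  obtain ⟨x, hx⟩ := Finset.nonempty_iff_ne_empty.2 hS
  refine h (acyclicAt_zero_of_singleton_mem (x := Fintype.equivFin V x) ?_)
  simp [mem_inducedIndComplex, hx]

lemma acyclicAt_inducedIndComplex_empty (m : ℕ) :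
    AcyclicAt K (inducedIndComplex G ∅) (m + 1) := by
  intro c hc _
  refine ⟨0, fun F hF => absurd rfl hF, ?_⟩
  rw [map_zero]
  ext F
  by_contra h
  obtain ⟨h1, h2⟩ := hc F (Ne.symm h)
  rw [mem_inducedIndComplex] at h1
  obtain ⟨u, hu⟩ : F.Nonempty := Finset.card_pos.1 (by omega)
  simpa using h1.2 u hu

/-- The independence complex of a graph with an isolated vertex is acyclic. -/
lemma acyclicAt_of_isolated {S : Finset V} {x : V} (hx : x ∈ S) (h : ∀ y ∈ S, ¬ G.Adj x y)
    (m : ℕ) : AcyclicAt K (inducedIndComplex G S) m := by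
  refine acyclicAt_of_insert_mem (x := Fintype.equivFin V x) (fun F hF => ?_) m
  exact insert_mem_inducedIndComplex.2
    ⟨hF, hx, fun u hu => h _ ((mem_inducedIndComplex.1 hF).2 u hu)⟩

open Classical in
/-- Acyclicity of the induced subgraphs obtained by deleting a vertex, and by deleting its closed
neighbourhood, implies acyclicity. -/
lemma acyclicAt_of_delete_vertex {S : Finset V} {x : V} (hx : x ∈ S) {m : ℕ}
    (h1 : AcyclicAt K (inducedIndComplex G (S.erase x)) (m + 1))
    (h2 : AcyclicAt K
      (inducedIndComplex G (S.filter fun y => y ≠ x ∧ ¬ G.Adj x y)) m) :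
    AcyclicAt K (inducedIndComplex G S) (m + 1) := by
  have key : ∀ F : Finset (Fin (Fintype.card V)), Fintype.equivFin V x ∉ F ↔
      ∀ u ∈ F, (Fintype.equivFin V).symm u ≠ x := by
    intro F
    simp only [ne_eq, Equiv.symm_apply_eq]
    exact ⟨fun h u hu hux => h (hux ▸ hu), fun h hF => h _ hF rfl⟩
  refine acyclicAt_of_deletion_of_link (x := Fintype.equivFin V x) (fun F => ?_) (fun F => ?_)
    mem_inducedIndComplex_of_subset h1 h2
  · rw [key, mem_inducedIndComplex, mem_inducedIndComplex]
    simp only [Finset.mem_erase]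
    grind
  · rw [key, insert_mem_inducedIndComplex, mem_inducedIndComplex, mem_inducedIndComplex]
    simp only [Finset.mem_filter]
    grind

open Classical in
/-- If `x` is a leaf attached to `y`, the closed neighbourhood of `y` may be deleted. -/
lemma acyclicAt_of_leaf {S : Finset V} {x y : V} (hx : x ∈ S) (hy : y ∈ S)
    (hxy : G.Adj x y) (hleaf : ∀ z ∈ S, G.Adj x z → z = y) {m : ℕ}
    (h : AcyclicAt K
      (inducedIndComplex G (S.filter fun z => z ≠ y ∧ ¬ G.Adj y z)) m) :
    AcyclicAt K (inducedIndComplex G S) (m + 1) := by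
  refine acyclicAt_of_delete_vertex K hy (acyclicAt_of_isolated K (x := x) ?_ ?_ _) h
  · exact Finset.mem_erase.2 ⟨hxy.ne, hx⟩
  · intro z hz hxz
    exact (Finset.mem_erase.1 hz).1 (hleaf z (Finset.mem_erase.1 hz).2 hxz)

end Induced

section Ladder

lemma graphB_adj {t : ℕ} {x y : Bool × Fin (t + 1)} :
    (graphB t).Adj x y ↔
      (x.1 = y.1 ∧ ((y.2 : ℕ) = (x.2 : ℕ) + 1 ∨ (x.2 : ℕ) = (y.2 : ℕ) + 1)) ∨
      ((x.2 : ℕ) = (y.2 : ℕ) ∧ x.1 ≠ y.1) := by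
  obtain ⟨p, i⟩ := x
  obtain ⟨q, j⟩ := y
  simp only [graphB, SimpleGraph.fromRel_adj, ne_eq, Prod.mk.injEq, Fin.ext_iff]
  grind

variable (K : Type*) [Field K] {t : ℕ}

/-- Removing the first two columns of an induced subgraph of the ladder lowers the homological
degree by one. -/
lemma exists_subset_not_acyclicAt {S : Finset (Bool × Fin (t + 1))} {x : Bool × Fin (t + 1)}
    (hx : x ∈ S) (hmin : ∀ y ∈ S, (x.2 : ℕ) ≤ y.2) {m : ℕ}
    (h : ¬ AcyclicAt K (inducedIndComplex (graphB t) S) (m + 1)) :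
    ∃ T : Finset (Bool × Fin (t + 1)), (∀ y ∈ T, (x.2 : ℕ) + 2 ≤ y.2) ∧
      ¬ AcyclicAt K (inducedIndComplex (graphB t) T) m := by
  classical
  contrapose! h
  obtain ⟨p, i⟩ := x
  simp only at hmin
  by_cases hr : ((!p), i) ∈ S
  · have hrung : (graphB t).Adj (p, i) (!p, i) := graphB_adj.2 (by simp)
    by_cases h1 : ∃ j : Fin (t + 1), (p, j) ∈ S ∧ (j : ℕ) = i + 1
    · by_cases h2 : ∃ j : Fin (t + 1), (!p, j) ∈ S ∧ (j : ℕ) = i + 1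
      · obtain ⟨j, hq, hj⟩ := h1
        obtain ⟨j', hq', hj'⟩ := h2
        refine acyclicAt_of_delete_vertex K hq ?_ ?_
        · refine acyclicAt_of_leaf K (x := (p, i)) (y := (!p, i)) ?_ ?_ hrung ?_ (h _ ?_)
          · simp [hx, Fin.ext_iff, hj]
          · simp [hr]
          · simp only [Finset.mem_erase, graphB_adj]
            rintro ⟨_ | _, k⟩ <;> cases p <;> grind
          · simp only [Finset.mem_filter, Finset.mem_erase, graphB_adj]
            rintro ⟨_ | _, k⟩ <;> cases p <;> grind
        · refine acyclicAt_of_isolated K (x := (!p, i)) ?_ ?_ _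
          · simp only [Finset.mem_filter, graphB_adj]
            cases p <;> grind
          · simp only [Finset.mem_filter, graphB_adj]
            rintro ⟨_ | _, k⟩ <;> cases p <;> grind
      · refine acyclicAt_of_leaf K hr hx hrung.symm ?_ (h _ ?_)
        · simp only [graphB_adj]
          rintro ⟨_ | _, k⟩ <;> cases p <;> grind
        · simp only [Finset.mem_filter, graphB_adj]
          rintro ⟨_ | _, k⟩ <;> cases p <;> grind
    · refine acyclicAt_of_leaf K hx hr hrung ?_ (h _ ?_)
      · simp only [graphB_adj]
        rintro ⟨_ | _, k⟩ <;> cases p <;> grind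
      · simp only [Finset.mem_filter, graphB_adj]
        rintro ⟨_ | _, k⟩ <;> cases p <;> grind
  · by_cases h1 : ∃ j : Fin (t + 1), (p, j) ∈ S ∧ (j : ℕ) = i + 1
    · obtain ⟨j, hq, hj⟩ := h1
      refine acyclicAt_of_leaf K hx hq (graphB_adj.2 (by simp [hj])) ?_ (h _ ?_)
      · simp only [graphB_adj]
        rintro ⟨_ | _, k⟩ <;> cases p <;> grind
      · simp only [Finset.mem_filter, graphB_adj]
        rintro ⟨_ | _, k⟩ <;> cases p <;> grind
    · refine acyclicAt_of_isolated K hx ?_ _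
      simp only [graphB_adj]
      rintro ⟨_ | _, k⟩ <;> cases p <;> grind

/-- An induced subgraph of the ladder on its last `l` columns has no homology in degree
`m` with `l + 1 < 2 * m`. -/
lemma two_mul_le_of_not_acyclicAt (l : ℕ) : ∀ (S : Finset (Bool × Fin (t + 1))) (m : ℕ),
    (∀ y ∈ S, t + 1 ≤ (y.2 : ℕ) + l) →
    ¬ AcyclicAt K (inducedIndComplex (graphB t) S) m → 2 * m ≤ l + 1 := by
  induction l using Nat.strong_induction_on with
  | _ l ih =>
    intro S m hS h
    rcases m with _ | m
    · omega
    rcases S.eq_empty_or_nonempty with rfl | hne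
    · exact absurd (acyclicAt_inducedIndComplex_empty K m) h
    obtain ⟨x, hx, hmin⟩ := S.exists_min_image (fun y => (y.2 : ℕ)) hne
    obtain ⟨T, hT, hTm⟩ := exists_subset_not_acyclicAt K hx hmin h
    have hxl := hS x hx
    have := x.2.isLt
    rcases l with _ | _ | l
    · omega
    · rcases T.eq_empty_or_nonempty with rfl | ⟨y, hy⟩
      · rcases m with _ | m
        · omega
        · exact absurd (acyclicAt_inducedIndComplex_empty K m) hTm
      · have := hT y hy
        have := y.2.isLt
        omega
    · have := ih l (by omega) T m (fun y hy => by have := hT y hy; omega) hTm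
      omega

lemma regEdgeIdeal_graphB_le (t : ℕ) : regEdgeIdeal K (graphB t) ≤ (t + 4) / 2 := by
  refine csSup_le' ?_
  rintro d ⟨i, j, hb, hd⟩
  rcases d with _ | d
  · omega
  obtain ⟨W, -, hW⟩ := Finset.exists_ne_zero_of_sum_ne_zero hb
  have hWS : (indComplex (graphB t)).filter (fun F => F ⊆ W) =
      inducedIndComplex (graphB t) (W.map (Fintype.equivFin _).symm.toEmbedding) := by
    rw [inducedIndComplex, Finset.map_map]
    simp
  have hdeg : (j : ℤ) - i - 2 = (d : ℤ) - 1 := by push_cast at hd; omega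
  rw [hWS, hdeg] at hW
  have := two_mul_le_of_not_acyclicAt K (t + 1) _ d (fun y _ => by omega)
    fun h => hW (h.reducedHomologyRank_eq_zero mem_inducedIndComplex_of_subset)
  omega

end Ladder

/-- **Lemma 4.2(ii).**
For `t ≥ 1`, the edge ideal of the ladder graph `B_t` satisfies
`reg(I(B_t)) ≤ (t+4)/2` if `t` is even and `reg(I(B_t)) ≤ (t+3)/2` if `t` is
odd. -/
theorem regularity_bound_graphB (K : Type*) [Field K] (t : ℕ) (ht : 1 ≤ t) :
    (Even t → regEdgeIdeal K (graphB t) ≤ (t + 4) / 2) ∧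
    (Odd t → regEdgeIdeal K (graphB t) ≤ (t + 3) / 2) := by
  have h := regEdgeIdeal_graphB_le K t
  exact ⟨fun _ => h, fun ho => by obtain ⟨r, rfl⟩ := ho; omega⟩
end
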